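/- For a generic endomorphism f of ℂⁿ (n ≥ 1): the set ℂⁿ \ rne(f) is contained in the closure of att(f); ℂⁿ \ rne(f) equals the closure of rep(f); and if n ≥ 2, ℂⁿ \ rne(f) equals the closure of sad(f). (Theorem 2.4 of the paper, proved for Oka-Stein manifolds; specialized to ℂⁿ.) -/

import Mathlib

open Function Topology Filter Metric

noncomputable section

/-- `ℂⁿ` as a Euclidean space. -/
abbrev Cn (n : ℕ) := EuclideanSpace ℂ (Fin n)

/-- The space `End(ℂⁿ)` of holomorphic self-maps of `ℂⁿ`, topologized as a subspace of
the continuous maps `C(ℂⁿ, ℂⁿ)` with the compact-open topology. -/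
abbrev Endo (n : ℕ) := {f : C(Cn n, Cn n) // Differentiable ℂ ⇑f}

variable {n : ℕ}

/-- The underlying function of an endomorphism. -/
def eapp (f : Endo n) : Cn n → Cn n := ⇑f.1

/-- `p` is a periodic point of `f`. -/
def IsPer (f : Endo n) (p : Cn n) : Prop := ∃ m, 1 ≤ m ∧ (eapp f)^[m] p = p

/-- The minimal period of a periodic point. -/
def minPer (f : Endo n) (p : Cn n) : ℕ := Function.minimalPeriod (eapp f) p

/-- The eigenvalues at a periodic point `p`: the spectrum of the derivative of the
`minPer f p`-th iterate at `p`. -/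
def eigs (f : Endo n) (p : Cn n) : Set ℂ := spectrum ℂ (fderiv ℂ ((eapp f)^[minPer f p]) p)

/-- Hyperbolic periodic point: no eigenvalue of absolute value 1. -/
def IsHypPer (f : Endo n) (p : Cn n) : Prop := IsPer f p ∧ ∀ z ∈ eigs f p, ‖z‖ ≠ 1

/-- Attracting periodic point: all eigenvalues of absolute value < 1. -/
def IsAttPer (f : Endo n) (p : Cn n) : Prop := IsPer f p ∧ ∀ z ∈ eigs f p, ‖z‖ < 1

/-- Repelling periodic point: all eigenvalues of absolute value > 1. -/
def IsRepPer (f : Endo n) (p : Cn n) : Prop := IsPer f p ∧ ∀ z ∈ eigs f p, 1 < ‖z‖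

/-- Saddle periodic point: hyperbolic with eigenvalues of absolute value both < 1 and > 1. -/
def IsSadPer (f : Endo n) (p : Cn n) : Prop :=
  IsHypPer f p ∧ (∃ z ∈ eigs f p, ‖z‖ < 1) ∧ (∃ z ∈ eigs f p, 1 < ‖z‖)

/-- Super-attracting periodic point: the derivative of the `minPer`-th iterate vanishes. -/
def IsSuperAttPer (f : Endo n) (p : Cn n) : Prop :=
  IsPer f p ∧ fderiv ℂ ((eapp f)^[minPer f p]) p = 0

/-- The set of attracting periodic points of `f`. -/
def attSet (f : Endo n) : Set (Cn n) := {p | IsAttPer f p}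

/-- The set of repelling periodic points of `f`. -/
def repSet (f : Endo n) : Set (Cn n) := {p | IsRepPer f p}

/-- The set of saddle periodic points of `f`. -/
def sadSet (f : Endo n) : Set (Cn n) := {p | IsSadPer f p}

/-- The robustly non-expelling set of `f`. -/
def rne (f : Endo n) : Set (Cn n) :=
  {p | ∃ U : Set (Cn n), IsOpen U ∧ p ∈ U ∧ ∃ V ∈ 𝓝 f, ∃ K : Set (Cn n),
        IsCompact K ∧ ∀ g ∈ V, ∀ j : ℕ, (eapp g)^[j] '' U ⊆ K}

/-- A sequence of maps diverges locally uniformly to infinity on `U`. -/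
def DivLocUnifOn (F : ℕ → Cn n → Cn n) (U : Set (Cn n)) : Prop :=
  ∀ L ⊆ U, IsCompact L → ∀ K : Set (Cn n), IsCompact K →
    ∀ᶠ j in atTop, Disjoint (F j '' L) K

/-- `p` belongs to the Fatou set of `f`: the iterates form a normal family near `p`. -/
def FatouAt (f : Endo n) (p : Cn n) : Prop :=
  ∃ U : Set (Cn n), IsOpen U ∧ p ∈ U ∧
    ∀ k : ℕ → ℕ, StrictMono k → ∃ l : ℕ → ℕ, StrictMono l ∧
      ((∃ g : Cn n → Cn n, DifferentiableOn ℂ g U ∧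
          TendstoLocallyUniformlyOn (fun j => (eapp f)^[k (l j)]) g atTop U) ∨
        DivLocUnifOn (fun j => (eapp f)^[k (l j)]) U)

/-- The Fatou set of `f`. -/
def Fatou (f : Endo n) : Set (Cn n) := {p | FatouAt f p}

/-- The Julia set of `f`. -/
def Julia (f : Endo n) : Set (Cn n) := (Fatou f)ᶜ

/-- The cycle (finite orbit) of a periodic point `p`. -/
def cycleOf (f : Endo n) (p : Cn n) : Set (Cn n) := {x | ∃ i < minPer f p, (eapp f)^[i] p = x}

/-- The basin of attraction of the cycle of `p`. -/
def basinOf (f : Endo n) (p : Cn n) : Set (Cn n) :=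
  {x | ∃ a ∈ cycleOf f p, Tendsto (fun k => (eapp f)^[minPer f p * k] x) atTop (𝓝 a)}

/-- The non-wandering set of `f`. -/
def nonWandering (f : Endo n) : Set (Cn n) :=
  {p | ∀ U ∈ 𝓝 p, ∃ k, 1 ≤ k ∧ (U ∩ (eapp f)^[k] '' U).Nonempty}

/-- The set of points whose orbit can be closed in the weak sense. -/
def cloSet (f : Endo n) : Set (Cn n) :=
  {p | ∀ U ∈ 𝓝 p, ∀ V ∈ 𝓝 f, ∃ g ∈ V, ∃ q ∈ U, IsPer g q}

/-- `𝒯(m,K)`: endomorphisms all of whose periodic points in `K` of minimal period at most `m`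
are transverse. -/
def TransSet (n : ℕ) (m : ℕ) (K : Set (Cn n)) : Set (Endo n) :=
  {f | ∀ p ∈ K, IsPer f p → minPer f p ≤ m → (1 : ℂ) ∉ eigs f p}

/-- `ℋ(m,K)`: endomorphisms all of whose periodic points in `K` of minimal period at most `m`
are hyperbolic. -/
def HypSet (n : ℕ) (m : ℕ) (K : Set (Cn n)) : Set (Endo n) :=
  {f | ∀ p ∈ K, IsPer f p → minPer f p ≤ m → ∀ z ∈ eigs f p, ‖z‖ ≠ 1}

/-- The `m`-th iterate of an endomorphism as an endomorphism. -/
def iterEndo (f : Endo n) (m : ℕ) : Endo n :=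
  ⟨⟨(eapp f)^[m], f.1.continuous.iterate m⟩, f.2.iterate m⟩

/-- The set of points with relatively compact forward orbit. -/
def boundedOrb (f : Endo n) : Set (Cn n) :=
  {p | ∃ K : Set (Cn n), IsCompact K ∧ ∀ k : ℕ, (eapp f)^[k] p ∈ K}

/-- An `ε`-chain (pseudo-orbit) of `f` from `x` to `y`. -/
def EpsChain (f : Endo n) (ε : Cn n → ℝ) (x y : Cn n) : Prop :=
  ∃ N : ℕ, 1 ≤ N ∧ ∃ c : ℕ → Cn n, c 0 = x ∧ c N = y ∧
    ∀ j < N, dist (eapp f (c j)) (c (j + 1)) < ε (eapp f (c j))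

/-- `x` and `y` are chain-equivalent for `f`. -/
def ChainEquiv (f : Endo n) (x y : Cn n) : Prop :=
  ∀ ε : Cn n → ℝ, Continuous ε → (∀ z, 0 < ε z) → EpsChain f ε x y ∧ EpsChain f ε y x

/-- `x` is chain-recurrent for `f`. -/
def ChainRec (f : Endo n) (x : Cn n) : Prop :=
  ∀ ε : Cn n → ℝ, Continuous ε → (∀ z, 0 < ε z) → EpsChain f ε x x

/-- Attracting fixed point. -/
def IsAttFix (f : Endo n) (p : Cn n) : Prop :=
  eapp f p = p ∧ ∀ z ∈ spectrum ℂ (fderiv ℂ (eapp f) p), ‖z‖ < 1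

/-- Repelling fixed point. -/
def IsRepFix (f : Endo n) (p : Cn n) : Prop :=
  eapp f p = p ∧ ∀ z ∈ spectrum ℂ (fderiv ℂ (eapp f) p), 1 < ‖z‖

/-- Saddle fixed point. -/
def IsSadFix (f : Endo n) (p : Cn n) : Prop :=
  eapp f p = p ∧ (∀ z ∈ spectrum ℂ (fderiv ℂ (eapp f) p), ‖z‖ ≠ 1) ∧
    (∃ z ∈ spectrum ℂ (fderiv ℂ (eapp f) p), ‖z‖ < 1) ∧
    (∃ z ∈ spectrum ℂ (fderiv ℂ (eapp f) p), 1 < ‖z‖)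

/-- `f` is a local biholomorphism at `p`: `f` agrees near `p` with a homeomorphism onto an
open set whose inverse is holomorphic. -/
def LocalBiholoAt (f : Endo n) (p : Cn n) : Prop :=
  ∃ φ : PartialHomeomorph (Cn n) (Cn n), p ∈ φ.source ∧ Set.EqOn (eapp f) φ φ.source ∧
    DifferentiableOn ℂ φ.symm φ.target

lemma eapp_diff (f : Endo n) : Differentiable ℂ (eapp f) := f.2

lemma eapp_cont (f : Endo n) : Continuous (eapp f) := f.1.continuous

/-- Make an endomorphism from a differentiable map. -/
def mkE (F : Cn n → Cn n) (hF : Differentiable ℂ F) : Endo n := ⟨⟨F, hF.continuous⟩, hF⟩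

lemma eapp_mkE (F : Cn n → Cn n) (hF : Differentiable ℂ F) : eapp (mkE F hF) = F := rfl

lemma iter_cont (m : ℕ) : Continuous (fun p : Endo n × Cn n => (eapp p.1)^[m] p.2) := by
  induction m with
  | zero => simpa using continuous_snd
  | succ k ih =>
    simp only [Function.iterate_succ_apply']
    have h1 : Continuous (fun p : Endo n × Cn n => p.1.1) := continuous_subtype_val.comp continuous_fst
    exact h1.eval ih

lemma iter_near (g : Endo n) (m : ℕ) (K : Set (Cn n)) (hK : IsCompact K) {ε : ℝ} (hε : 0 < ε) :
    ∀ᶠ h in 𝓝 g, ∀ z ∈ K, ‖(eapp h)^[m] z - (eapp g)^[m] z‖ < ε := by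
  apply hK.eventually_forall_of_forall_eventually
    (P := fun h z => ‖(eapp h)^[m] z - (eapp g)^[m] z‖ < ε)
  intro y _
  have h2 : Continuous (fun p : Endo n × Cn n => ‖(eapp p.1)^[m] p.2 - (eapp g)^[m] p.2‖) :=
    ((iter_cont m).sub (((eapp_cont g).iterate m).comp continuous_snd)).norm
  exact h2.continuousAt.eventually_lt continuousAt_const (by simpa using hε)

lemma nhds_ball (f : Endo n) (W : Set (Endo n)) (hW : W ∈ 𝓝 f) :
    ∃ R : ℝ, 0 < R ∧ ∃ ε : ℝ, 0 < ε ∧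
      ∀ g : Endo n, (∀ z, ‖z‖ ≤ R → ‖eapp g z - eapp f z‖ < ε) → g ∈ W := by
  rw [nhds_subtype_eq_comap] at hW
  obtain ⟨T, hT, hTW⟩ := hW
  rw [UniformSpace.mem_nhds_iff] at hT
  obtain ⟨X, hX, hXT⟩ := hT
  rw [ContinuousMap.mem_compactConvergence_entourage_iff] at hX
  obtain ⟨K, V, hK, hV, hKV⟩ := hX
  obtain ⟨ε, hε, hεV⟩ := Metric.mem_uniformity_dist.1 hV
  obtain ⟨R, hR, hKR⟩ := hK.isBounded.exists_pos_norm_le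
  refine ⟨R, hR, ε, hε, fun g hg => hTW (hXT (hKV ?_))⟩
  intro x hx
  apply hεV
  rw [dist_comm, dist_eq_norm]
  exact hg x (hKR x hx)

lemma cauchy_bd (G : Cn n → Cn n) (hG : Differentiable ℂ G) (x : Cn n) {r M : ℝ} (hr : 0 < r)
    (hM : ∀ z ∈ ball x r, ‖G z‖ ≤ M) : ‖fderiv ℂ G x‖ ≤ 2 * M / r := by
  refine Complex.norm_fderiv_le_div_of_mapsTo_ball hG.differentiableOn ?_ hr
  intro z hz
  have h1 := hM z hz
  have h2 := hM x (mem_ball_self hr)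
  rw [mem_closedBall, dist_eq_norm]
  linarith [norm_sub_le (G z) (G x)]

lemma robust [Nontrivial (Cn n)] (A : Cn n →L[ℂ] Cn n) (hA : A * A = (2 : ℂ) • A) {δ : ℝ} (hδ : 0 < δ) :
    ∃ c : ℝ, 0 < c ∧ ∀ (q : Cn n) (r : ℝ) (G : Cn n → Cn n), 0 < r → Differentiable ℂ G →
      (∀ z ∈ closedBall q (2 * r), ‖G z - q - A (z - q)‖ ≤ c * r) →
      ∃ q' ∈ closedBall q r, G q' = q' ∧ ‖fderiv ℂ G q' - A‖ ≤ δ := by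
  have hAA : ∀ x, A (A x) = (2 : ℂ) • A x := fun x => by
    have := congrArg (fun T : Cn n →L[ℂ] Cn n => T x) hA
    simpa using this
  have hinv : ∀ x, (A - 1) ((A - 1) x) = x := fun x => by
    simp only [_root_.sub_apply, one_apply_eq_self, map_sub, hAA]
    rw [two_smul]; abel
  let e : Cn n ≃L[ℂ] Cn n := ContinuousLinearEquiv.equivOfInverse (A - 1) (A - 1) hinv hinv
  let S := e.toNonlinearRightInverse
  have hecoe : (e : Cn n →L[ℂ] Cn n) = A - 1 := by ext; rfl
  set N : ℝ := ‖A - 1‖ + 1 with hN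
  have hNpos : 0 < N := by positivity
  obtain ⟨c, hc, hc1, hc2⟩ : ∃ c : ℝ, 0 < c ∧ 2 * c ≤ δ ∧ 3 * c ≤ N⁻¹ := by
    refine ⟨min (δ / 2) (N⁻¹ / 3), by positivity, ?_, ?_⟩
    · linarith [min_le_left (δ / 2) (N⁻¹ / 3)]
    · linarith [min_le_right (δ / 2) (N⁻¹ / 3)]
  refine ⟨c, hc, fun q r G hr hG hGA => ?_⟩
  set H : Cn n → Cn n := fun z => G z - q - A (z - q) with hH
  have hHd : Differentiable ℂ H := by
    apply Differentiable.sub (hG.sub_const q)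
    exact A.differentiable.comp (differentiable_id.sub_const q)
  have hHf : ∀ x, fderiv ℂ H x = fderiv ℂ G x - A := fun x => by
    have h1 : HasFDerivAt H (fderiv ℂ G x - A) x := by
      apply HasFDerivAt.sub ((hG x).hasFDerivAt.sub_const q)
      have := A.hasFDerivAt.comp x ((hasFDerivAt_id (𝕜 := ℂ) x).sub_const q)
      rw [ContinuousLinearMap.comp_id] at this
      exact this
    exact h1.fderiv
  have hb : ∀ x ∈ closedBall q r, ‖fderiv ℂ H x‖ ≤ 2 * c := by
    intro x hx
    have := cauchy_bd H hHd x hr (M := c * r) (fun z hz => hGA z ?_)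
    · refine this.trans (le_of_eq ?_); field_simp
    · rw [mem_closedBall] at hx ⊢
      rw [mem_ball] at hz
      linarith [dist_triangle z x q]
  let F : Cn n → Cn n := fun z => G z - z
  have happ : ApproximatesLinearOn F (e : Cn n →L[ℂ] Cn n) (closedBall q r) ⟨2 * c, by positivity⟩ := by
    intro x hx y hy
    have := (convex_closedBall q r).norm_image_sub_le_of_norm_fderiv_le (𝕜 := ℂ)
      (fun z _ => hHd z) hb hy hx
    rw [hecoe]
    have e1 : F x - F y - (A - 1) (x - y) = H x - H y := by
      simp only [F, hH, _root_.sub_apply, one_apply_eq_self, map_sub]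
      abel
    rw [e1]; exact this
  have hs := happ.surjOn_closedBall_of_nonlinearRightInverse S hr.le (subset_refl _)
  have hSn : (S.nnnorm : ℝ) = ‖A - 1‖ := rfl
  have h0 : (0 : Cn n) ∈ closedBall (F q) (((S.nnnorm : ℝ)⁻¹ - (⟨2 * c, by positivity⟩ : NNReal)) * r) := by
    rw [mem_closedBall, dist_comm, dist_zero_right]
    have h1 : ‖F q‖ ≤ c * r := by
      have := hGA q (by simp; positivity)
      simpa [F] using this
    refine h1.trans ?_
    apply mul_le_mul_of_nonneg_right _ hr.le
    rw [hSn]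
    show c ≤ ‖A - 1‖⁻¹ - 2 * c
    by_cases hz : ‖A - 1‖ = 0
    · exfalso
      obtain ⟨x, hx⟩ := exists_ne (0 : Cn n)
      apply hx
      rw [← hinv x, norm_eq_zero.1 hz]
      simp
    · have : N⁻¹ ≤ ‖A - 1‖⁻¹ := by
        apply inv_anti₀ (lt_of_le_of_ne (norm_nonneg _) (Ne.symm hz))
        rw [hN]; linarith
      linarith
  obtain ⟨q', hq', hFq'⟩ := hs h0
  refine ⟨q', hq', sub_eq_zero.1 hFq', ?_⟩
  rw [← hHf]
  exact (hb q' hq').trans hc1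

lemma exists_w (S : Finset (Cn n)) (y : Cn n) (hy : y ∉ S) :
    ∃ w : Cn n → ℂ, Differentiable ℂ w ∧ w y = 1 ∧ ∀ s ∈ S, w s = 0 := by
  classical
  induction S using Finset.induction_on with
  | empty => exact ⟨fun _ => 1, differentiable_const _, rfl, by simp⟩
  | insert a S ha ih =>
    obtain ⟨w, hw, hw1, hw0⟩ := ih (fun h => hy (Finset.mem_insert_of_mem h))
    have hya : y - a ≠ 0 := sub_ne_zero.2 (fun h => hy (h ▸ Finset.mem_insert_self _ _))
    have hne : inner ℂ (y - a) (y - a) ≠ 0 := inner_self_ne_zero.2 hya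
    refine ⟨fun z => (inner ℂ (y - a) (y - a))⁻¹ * (innerSL ℂ (y - a) (z - a)) * w z, ?_, ?_, ?_⟩
    · exact (((innerSL ℂ (y - a)).differentiable.comp (differentiable_id.sub_const a)).const_mul _).mul hw
    · simp only [innerSL_apply_apply, hw1, mul_one]
      exact inv_mul_cancel₀ hne
    · intro s hs
      rcases Finset.mem_insert.1 hs with rfl | hs
      · simp
      · simp [hw0 s hs]

lemma flat_of_w (w : Cn n → ℂ) (hw : Differentiable ℂ w) :
    Differentiable ℂ (fun z => (w z) ^ 2 * (2 - (w z) ^ 2)) ∧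
    (∀ x, w x = 0 ∨ w x = 1 → HasFDerivAt (fun z => (w z) ^ 2 * (2 - (w z) ^ 2)) (0 : Cn n →L[ℂ] ℂ) x) := by
  refine ⟨(hw.pow 2).mul ((hw.pow 2).const_sub 2), fun x hx => ?_⟩
  have h1 : HasDerivAt (fun u : ℂ => u ^ 2 * (2 - u ^ 2)) 0 (w x) := by
    have h := (hasDerivAt_pow 2 (w x)).mul ((hasDerivAt_pow 2 (w x)).const_sub 2)
    refine h.congr_deriv ?_
    rcases hx with hx | hx <;> rw [hx] <;> norm_num
  have h2 := h1.comp_hasFDerivAt x (hw x).hasFDerivAt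
  refine h2.congr_fderiv ?_
  ext v; simp

lemma exists_psi (S : Finset (Cn n)) (y : Cn n) (hy : y ∉ S) :
    ∃ ψ : Cn n → ℂ, Differentiable ℂ ψ ∧ ψ y = 1 ∧ HasFDerivAt ψ (0 : Cn n →L[ℂ] ℂ) y ∧
      ∀ s ∈ S, ψ s = 0 ∧ HasFDerivAt ψ (0 : Cn n →L[ℂ] ℂ) s := by
  obtain ⟨w, hw, hw1, hw0⟩ := exists_w S y hy
  obtain ⟨h1, h2⟩ := flat_of_w w hw
  refine ⟨_, h1, by simp [hw1]; norm_num, h2 y (Or.inr hw1), fun s hs => ⟨by simp [hw0 s hs], h2 s (Or.inl (hw0 s hs))⟩⟩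

lemma exists_psi_small (S : Finset (Cn n)) (y : Cn n) (hy : y ∉ S) {R η : ℝ} (hR : 0 ≤ R)
    (hRy : R < ‖y‖) (hη : 0 < η) :
    ∃ ψ : Cn n → ℂ, Differentiable ℂ ψ ∧ ψ y = 1 ∧ HasFDerivAt ψ (0 : Cn n →L[ℂ] ℂ) y ∧
      (∀ s ∈ S, ψ s = 0 ∧ HasFDerivAt ψ (0 : Cn n →L[ℂ] ℂ) s) ∧ ∀ z, ‖z‖ ≤ R → ‖ψ z‖ ≤ η := by
  obtain ⟨w, hw, hw1, hw0⟩ := exists_w S y hy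
  have hypos : 0 < ‖y‖ := lt_of_le_of_lt hR hRy
  have hy0 : y ≠ 0 := norm_pos_iff.1 hypos
  have hne : inner ℂ y y ≠ 0 := inner_self_ne_zero.2 hy0
  obtain ⟨C, hC⟩ := (isCompact_closedBall (0 : Cn n) R).exists_bound_of_continuousOn hw.continuous.continuousOn
  let ℓ : Cn n → ℂ := fun z => (inner ℂ y y)⁻¹ * innerSL ℂ y z
  have hℓd : Differentiable ℂ ℓ := (innerSL ℂ y).differentiable.const_mul _
  have hℓ1 : ℓ y = 1 := inv_mul_cancel₀ hne
  have hℓb : ∀ z, ‖z‖ ≤ R → ‖ℓ z‖ ≤ R / ‖y‖ := by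
    intro z hz
    have h1 : ‖inner ℂ y z‖ ≤ ‖y‖ * ‖z‖ := norm_inner_le_norm y z
    have h2 : ‖inner ℂ y y‖ = ‖y‖ * ‖y‖ := by
      rw [inner_self_eq_norm_sq_to_K]; simp [sq]
    simp only [ℓ, innerSL_apply_apply, norm_mul, norm_inv, h2]
    calc (‖y‖ * ‖y‖)⁻¹ * ‖inner ℂ y z‖ ≤ (‖y‖ * ‖y‖)⁻¹ * (‖y‖ * R) := by gcongr; exact h1.trans (by gcongr)
      _ = R / ‖y‖ := by field_simp
  have hlt : R / ‖y‖ < 1 := (div_lt_one hypos).2 hRy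
  have hnn : 0 ≤ R / ‖y‖ := by positivity
  set D := |C| + 1 with hD
  have hDpos : 0 < D := by positivity
  obtain ⟨N, hN⟩ := exists_pow_lt_of_lt_one (show 0 < min 1 (η / 3) / D by positivity) hlt
  have hw' : Differentiable ℂ (fun z => (ℓ z) ^ N * w z) := (hℓd.pow N).mul hw
  have hw'1 : (ℓ y) ^ N * w y = 1 := by rw [hℓ1, hw1]; simp
  have hw'0 : ∀ s ∈ S, (ℓ s) ^ N * w s = 0 := fun s hs => by rw [hw0 s hs]; simp
  obtain ⟨h1, h2⟩ := flat_of_w _ hw'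
  refine ⟨_, h1, by simp only [hw'1]; norm_num, h2 y (Or.inr hw'1),
    fun s hs => ⟨by simp only [hw'0 s hs]; norm_num, h2 s (Or.inl (hw'0 s hs))⟩, ?_⟩
  intro z hz
  have hb : ‖(ℓ z) ^ N * w z‖ ≤ min 1 (η / 3) := by
    rw [norm_mul, norm_pow]
    have hwz : ‖w z‖ ≤ D := by
      have := hC z (by simpa using hz)
      linarith [le_abs_self C]
    calc ‖ℓ z‖ ^ N * ‖w z‖ ≤ (R / ‖y‖) ^ N * D := by gcongr; exact hℓb z hz
      _ ≤ (min 1 (η / 3) / D) * D := by gcongr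
      _ = _ := by field_simp
  set u := (ℓ z) ^ N * w z
  have hu1 : ‖u‖ ≤ 1 := hb.trans (min_le_left _ _)
  have hu2 : ‖u‖ ≤ η / 3 := hb.trans (min_le_right _ _)
  have h3 : ‖(2 : ℂ) - u ^ 2‖ ≤ 3 := by
    refine (norm_sub_le _ _).trans ?_
    rw [norm_pow]
    have : ‖u‖ ^ 2 ≤ 1 := pow_le_one₀ (norm_nonneg _) hu1
    have : ‖(2 : ℂ)‖ = 2 := by simp
    linarith
  have h4 : ‖u ^ 2‖ ≤ η / 3 := by
    rw [norm_pow, sq]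
    nlinarith [norm_nonneg u]
  show ‖u ^ 2 * (2 - u ^ 2)‖ ≤ η
  rw [norm_mul]
  calc _ ≤ η / 3 * 3 := by gcongr
    _ = η := by ring

/-- interpolate at `y` outside the ball -/
lemma perturb2 (g : Endo n) (S : Finset (Cn n)) (y : Cn n) (hy : y ∉ S) {R ε : ℝ} (hR : 0 ≤ R)
    (hRy : R < ‖y‖) (hε : 0 < ε) (a : Cn n) (L : Cn n →L[ℂ] Cn n) :
    ∃ h : Endo n, (∀ z, ‖z‖ ≤ R → ‖eapp h z - eapp g z‖ < ε) ∧
      (∀ s ∈ S, eapp h s = eapp g s ∧ fderiv ℂ (eapp h) s = fderiv ℂ (eapp g) s) ∧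
      eapp h y = a ∧ fderiv ℂ (eapp h) y = L := by
  let Q : Cn n → Cn n := fun z => (a - eapp g y) + (L - fderiv ℂ (eapp g) y) (z - y)
  have hQf : ∀ x, HasFDerivAt Q (L - fderiv ℂ (eapp g) y) x := fun x => by
    have := (L - fderiv ℂ (eapp g) y).hasFDerivAt.comp x ((hasFDerivAt_id (𝕜 := ℂ) x).sub_const y)
    rw [ContinuousLinearMap.comp_id] at this
    exact this.const_add _
  have hQd : Differentiable ℂ Q := fun x => (hQf x).differentiableAt
  have hQy : Q y = a - eapp g y := by simp [Q]
  obtain ⟨C, hC⟩ := (isCompact_closedBall (0 : Cn n) R).exists_bound_of_continuousOn hQd.continuous.continuousOn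
  have hCpos : 0 < |C| + 1 := by positivity
  obtain ⟨ψ, hψd, hψ1, hψ1', hψ0, hψs⟩ := exists_psi_small S y hy hR hRy
    (show 0 < ε / 2 / (|C| + 1) by positivity)
  have hg := eapp_diff g
  have key : ∀ x, HasFDerivAt ψ (0 : Cn n →L[ℂ] ℂ) x →
      HasFDerivAt (fun z => eapp g z + ψ z • Q z)
        (fderiv ℂ (eapp g) x + ψ x • (L - fderiv ℂ (eapp g) y)) x := fun x hx => by
    have := (hg x).hasFDerivAt.add (hx.smul (hQf x))
    refine this.congr_fderiv ?_
    ext v; simp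
  refine ⟨mkE (fun z => eapp g z + ψ z • Q z) (hg.add (hψd.smul hQd)), ?_, ?_, ?_, ?_⟩
  · intro z hz
    rw [eapp_mkE]
    simp only [add_sub_cancel_left, norm_smul]
    have h1 : ‖Q z‖ ≤ |C| + 1 := by
      have := hC z (by simpa using hz)
      linarith [le_abs_self C]
    calc ‖ψ z‖ * ‖Q z‖ ≤ ε / 2 / (|C| + 1) * (|C| + 1) := by gcongr; exact hψs z hz
      _ = ε / 2 := by field_simp
      _ < ε := by linarith
  · intro s hs
    rw [eapp_mkE]
    refine ⟨by simp [(hψ0 s hs).1], ?_⟩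
    rw [(key s (hψ0 s hs).2).fderiv, (hψ0 s hs).1]; ext v; simp
  · rw [eapp_mkE]; simp [hψ1, hQy]
  · rw [eapp_mkE, (key y hψ1').fderiv, hψ1]; simp

lemma spec_finite (B : Cn n →L[ℂ] Cn n) : (spectrum ℂ B).Finite := by
  rw [← AlgEquiv.spectrum_eq (Module.End.toContinuousLinearMap (𝕜 := ℂ) (Cn n)).symm B]
  exact Module.End.finite_spectrum _

/-- make derivatives invertible -/
lemma perturb1 (g : Endo n) (S : Finset (Cn n)) (R : ℝ) {ε : ℝ} (hε : 0 < ε) :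
    ∃ h : Endo n, (∀ z, ‖z‖ ≤ R → ‖eapp h z - eapp g z‖ < ε) ∧
      (∀ s ∈ S, eapp h s = eapp g s ∧ IsUnit (fderiv ℂ (eapp h) s)) := by
  classical
  have hψ : ∀ y : Cn n, ∃ ψ : Cn n → ℂ, Differentiable ℂ ψ ∧ ψ y = 1 ∧
      HasFDerivAt ψ (0 : Cn n →L[ℂ] ℂ) y ∧
      ∀ s ∈ S.erase y, ψ s = 0 ∧ HasFDerivAt ψ (0 : Cn n →L[ℂ] ℂ) s :=
    fun y => exists_psi (S.erase y) y (by simp)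
  choose ψ hψd hψ1 hψ1' hψ0 using hψ
  let φ : Cn n → Cn n := fun z => ∑ s ∈ S, ψ s z • (z - s)
  have hφd : Differentiable ℂ φ :=
    Differentiable.fun_sum fun s _ => (hψd s).smul (differentiable_id.sub_const s)
  have hφ0 : ∀ x ∈ S, φ x = 0 := fun x hx => by
    apply Finset.sum_eq_zero
    intro s hs
    by_cases h : x = s
    · simp [h]
    · simp [(hψ0 s x (Finset.mem_erase.2 ⟨h, hx⟩)).1]
  have hφf : ∀ x ∈ S, HasFDerivAt φ (1 : Cn n →L[ℂ] Cn n) x := fun x hx => by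
    have h1 : ∀ s ∈ S, HasFDerivAt (fun z => ψ s z • (z - s))
        (if s = x then (1 : Cn n →L[ℂ] Cn n) else 0) x := fun s hs => by
      by_cases h : s = x
      · subst h
        have := (hψ1' s).smul ((hasFDerivAt_id (𝕜 := ℂ) s).sub_const s)
        refine this.congr_fderiv ?_
        ext v; simp [hψ1]
      · obtain ⟨e1, e2⟩ := hψ0 s x (Finset.mem_erase.2 ⟨fun h' => h h'.symm, hx⟩)
        have := e2.smul ((hasFDerivAt_id (𝕜 := ℂ) x).sub_const s)
        refine this.congr_fderiv ?_
        ext v; simp [e1, h]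
    have h2 := HasFDerivAt.fun_sum h1
    rw [Finset.sum_ite_eq_of_mem' S x _ hx] at h2
    exact h2
  obtain ⟨C, hC⟩ := (isCompact_closedBall (0 : Cn n) R).exists_bound_of_continuousOn hφd.continuous.continuousOn
  have hCpos : 0 < |C| + 1 := by positivity
  have hg := eapp_diff g
  -- choose t
  have hfin : (⋃ s ∈ S, spectrum ℂ (fderiv ℂ (eapp g) s)).Finite :=
    Set.Finite.biUnion S.finite_toSet fun s _ => spec_finite _
  have hev : ∀ᶠ t : ℂ in 𝓝[≠] 0, -t ∉ ⋃ s ∈ S, spectrum ℂ (fderiv ℂ (eapp g) s) := by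
    have hT : Tendsto (fun t : ℂ => -t) (𝓝[≠] 0) (𝓝[≠] 0) := by
      apply tendsto_nhdsWithin_of_tendsto_nhds_of_eventually_within
      · have : Tendsto (fun t : ℂ => -t) (𝓝 0) (𝓝 0) := by
          simpa using (continuous_neg (G := ℂ)).tendsto 0
        exact this.mono_left nhdsWithin_le_nhds
      · filter_upwards [self_mem_nhdsWithin] with t ht
        simpa using ht
    exact hT.eventually (nhdsNE_le_cofinite _ hfin.compl_mem_cofinite)
  have hev2 : ∀ᶠ t : ℂ in 𝓝[≠] 0, ‖t‖ < ε / (|C| + 1) := by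
    apply eventually_nhdsWithin_of_eventually_nhds
    have := Metric.ball_mem_nhds (0 : ℂ) (show 0 < ε / (|C| + 1) by positivity)
    filter_upwards [this] with t ht
    simpa using ht
  obtain ⟨t, ht1, ht2⟩ := (hev.and hev2).exists
  refine ⟨mkE (fun z => eapp g z + t • φ z) (hg.add (hφd.const_smul t)), ?_, ?_⟩
  · intro z hz
    rw [eapp_mkE]
    simp only [add_sub_cancel_left, norm_smul]
    have h1 : ‖φ z‖ ≤ |C| := by
      have := hC z (by simpa using hz)
      linarith [le_abs_self C]
    calc ‖t‖ * ‖φ z‖ ≤ ‖t‖ * (|C| + 1) := by gcongr; linarith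
      _ < ε / (|C| + 1) * (|C| + 1) := by gcongr
      _ = ε := by field_simp
  · intro s hs
    rw [eapp_mkE]
    refine ⟨by simp [hφ0 s hs], ?_⟩
    rw [((hg s).hasFDerivAt.fun_add ((hφf s hs).fun_const_smul t)).fderiv]
    have h3 : -t ∉ spectrum ℂ (fderiv ℂ (eapp g) s) := fun h => ht1 (Set.mem_biUnion hs h)
    rw [spectrum.notMem_iff] at h3
    rw [← IsUnit.neg_iff]
    convert h3 using 1
    rw [Algebra.algebraMap_eq_smul_one]
    simp only [neg_smul, neg_add]
    abel

lemma fderiv_iter_succ (f : Endo n) (k : ℕ) (q : Cn n) :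
    fderiv ℂ ((eapp f)^[k + 1]) q = fderiv ℂ (eapp f) ((eapp f)^[k] q) * fderiv ℂ ((eapp f)^[k]) q := by
  rw [Function.iterate_succ']
  exact fderiv_comp q (eapp_diff f _) ((eapp_diff f).iterate k _)

lemma close_up (f : Endo n) (p : Cn n) (hp : p ∉ rne f) (U : Set (Cn n)) (hU : IsOpen U) (hpU : p ∈ U)
    (W : Set (Endo n)) (hW : W ∈ 𝓝 f) (A : Cn n →L[ℂ] Cn n) :
    ∃ h ∈ W, ∃ q ∈ U, ∃ m, 1 ≤ m ∧ (eapp h)^[m] q = q ∧ fderiv ℂ ((eapp h)^[m]) q = A := by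
  classical
  obtain ⟨R, hR, ε, hε, hRW⟩ := nhds_ball f W hW
  have hε3 : 0 < ε / 3 := by positivity
  have hV : ∀ᶠ g in 𝓝 f, ∀ z ∈ closedBall (0 : Cn n) R, ‖eapp g z - eapp f z‖ < ε / 3 := by
    simpa using iter_near f 1 _ (isCompact_closedBall (0 : Cn n) R) hε3
  obtain ⟨g, hg, q, hq, hex⟩ : ∃ g : Endo n, (∀ z ∈ closedBall (0 : Cn n) R, ‖eapp g z - eapp f z‖ < ε / 3) ∧
      ∃ q ∈ U, ∃ j, (eapp g)^[j] q ∉ closedBall (0 : Cn n) R := by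
    by_contra hcon
    push Not at hcon
    apply hp
    refine ⟨U, hU, hpU, _, hV, closedBall 0 R, isCompact_closedBall _ _, ?_⟩
    rintro g hg j _ ⟨q, hq, rfl⟩
    exact hcon g hg q hq j
  let j := Nat.find hex
  have hj : (eapp g)^[j] q ∉ closedBall (0 : Cn n) R := Nat.find_spec hex
  have hjmin : ∀ i < j, (eapp g)^[i] q ∈ closedBall (0 : Cn n) R := fun i hi => by
    have := Nat.find_min hex hi
    simpa using this
  let S : Finset (Cn n) := (Finset.range j).image fun i => (eapp g)^[i] q
  have hmS : ∀ i < j, (eapp g)^[i] q ∈ S := fun i hi =>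
    Finset.mem_image_of_mem _ (Finset.mem_range.2 hi)
  have hyS : (eapp g)^[j] q ∉ S := fun h => by
    obtain ⟨i, hi, he⟩ := Finset.mem_image.1 h
    exact hj (he ▸ hjmin i (Finset.mem_range.1 hi))
  obtain ⟨g', hg', hg'S⟩ := perturb1 g S R hε3
  have hit : ∀ h : Endo n, (∀ s ∈ S, eapp h s = eapp g s) → ∀ i ≤ j, (eapp h)^[i] q = (eapp g)^[i] q := by
    intro h hh i
    induction i with
    | zero => intro _; rfl
    | succ i ih =>
      intro hi
      rw [Function.iterate_succ_apply', Function.iterate_succ_apply', ih (by omega)]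
      exact hh _ (hmS i hi)
  have hyR : R < ‖(eapp g)^[j] q‖ := by simpa using hj
  have hunit : ∀ h : Endo n, (∀ s ∈ S, eapp h s = eapp g s ∧ IsUnit (fderiv ℂ (eapp h) s)) →
      ∀ i ≤ j, IsUnit (fderiv ℂ ((eapp h)^[i]) q) := by
    intro h hh i
    induction i with
    | zero => intro _; rw [Function.iterate_zero, fderiv_id]; exact isUnit_one
    | succ i ih =>
      intro hi
      rw [fderiv_iter_succ, hit h (fun s hs => (hh s hs).1) i (by omega)]
      exact (hh _ (hmS i hi)).2.mul (ih (by omega))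
  have heq : ∀ h : Endo n, (∀ s ∈ S, eapp h s = eapp g' s ∧ fderiv ℂ (eapp h) s = fderiv ℂ (eapp g') s) →
      ∀ i ≤ j, fderiv ℂ ((eapp h)^[i]) q = fderiv ℂ ((eapp g')^[i]) q := by
    intro h hh i
    induction i with
    | zero => intro _; rfl
    | succ i ih =>
      intro hi
      rw [fderiv_iter_succ, fderiv_iter_succ, ih (by omega),
        hit h (fun s hs => (hh s hs).1.trans (hg'S s hs).1) i (by omega),
        hit g' (fun s hs => (hg'S s hs).1) i (by omega), (hh _ (hmS i hi)).2]
  obtain ⟨B, hB⟩ := hunit g' hg'S j le_rfl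
  obtain ⟨h, hh, hhS, hhy, hhL⟩ := perturb2 g' S ((eapp g)^[j] q) hyS hR.le hyR hε3 q
    (A * ((B⁻¹ : (Cn n →L[ℂ] Cn n)ˣ) : Cn n →L[ℂ] Cn n))
  have hhj : (eapp h)^[j] q = (eapp g)^[j] q :=
    hit h (fun s hs => (hhS s hs).1.trans (hg'S s hs).1) j le_rfl
  refine ⟨h, hRW h ?_, q, hq, j + 1, by omega, ?_, ?_⟩
  · intro z hz
    have h1 := hh z hz
    have h2 := hg' z hz
    have h3 := hg z (by simpa using hz)
    have e : eapp h z - eapp f z = (eapp h z - eapp g' z) + (eapp g' z - eapp g z) + (eapp g z - eapp f z) := by abel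
    rw [e]
    have := norm_add₃_le (a := eapp h z - eapp g' z) (b := eapp g' z - eapp g z) (c := eapp g z - eapp f z)
    linarith
  · rw [Function.iterate_succ_apply', hhj, hhy]
  · rw [fderiv_iter_succ, hhj, hhL, heq h hhS j le_rfl, ← hB]
    simp [mul_assoc]

lemma robust_open [Nontrivial (Cn n)] (A : Cn n →L[ℂ] Cn n) (hA : A * A = (2 : ℂ) • A) {δ : ℝ} (hδ : 0 < δ)
    (g : Endo n) (q : Cn n) (m : ℕ) (hq : (eapp g)^[m] q = q) (hD : fderiv ℂ ((eapp g)^[m]) q = A)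
    (B : Set (Cn n)) (hB : IsOpen B) (hqB : q ∈ B) :
    ∀ᶠ h in 𝓝 g, ∃ q' ∈ B, (eapp h)^[m] q' = q' ∧ ‖fderiv ℂ ((eapp h)^[m]) q' - A‖ ≤ δ := by
  obtain ⟨c, hc, hrob⟩ := robust A hA hδ
  have hd : HasFDerivAt ((eapp g)^[m]) A q := hD ▸ ((eapp_diff g).iterate m q).hasFDerivAt
  have hlit := hd.isLittleO.def (show 0 < c / 4 by positivity)
  obtain ⟨ρ, hρ, hρs⟩ := Metric.eventually_nhds_iff_ball.1 (hlit.and (hB.mem_nhds hqB))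
  let r := ρ / 3
  have hr : 0 < r := by positivity
  filter_upwards [iter_near g m _ (isCompact_closedBall q (2 * r)) (show 0 < c / 2 * r by positivity)] with h hh
  obtain ⟨q', hq', e1, e2⟩ := hrob q r ((eapp h)^[m]) hr ((eapp_diff h).iterate m) (fun z hz => by
    have h1 := hh z hz
    have hz' : dist z q ≤ 2 * r := hz
    have h2 := (hρs z (by rw [mem_ball]; simp only [r] at hz'; linarith)).1
    rw [hq] at h2
    have h3 : ‖z - q‖ ≤ 2 * r := by rw [← dist_eq_norm]; exact hz'
    have e : (eapp h)^[m] z - q - A (z - q) =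
      ((eapp h)^[m] z - (eapp g)^[m] z) + ((eapp g)^[m] z - q - A (z - q)) := by abel
    rw [e]
    refine (norm_add_le _ _).trans ?_
    nlinarith)
  refine ⟨q', (hρs q' ?_).2, e1, e2⟩
  rw [mem_closedBall] at hq'
  rw [mem_ball]; simp only [r] at hq'; linarith

lemma generic_subset [Nontrivial (Cn n)] (S : Endo n → Set (Cn n)) (A : Cn n →L[ℂ] Cn n)
    (hA : A * A = (2 : ℂ) • A) {δ : ℝ} (hδ : 0 < δ)
    (hS : ∀ (f : Endo n) (q : Cn n) (m : ℕ), 1 ≤ m → (eapp f)^[m] q = q →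
      ‖fderiv ℂ ((eapp f)^[m]) q - A‖ ≤ δ → q ∈ S f) :
    {f : Endo n | (rne f)ᶜ ⊆ closure (S f)} ∈ residual (Endo n) := by
  let b := TopologicalSpace.countableBasis (Cn n)
  let O : Set (Cn n) → Set (Endo n) := fun B => interior {f | (B ∩ S f).Nonempty}
  have h1 : (⋂ B ∈ b, (O B ∪ (closure (O B))ᶜ)) ∈ residual (Endo n) := by
    rw [countable_bInter_mem (TopologicalSpace.countable_countableBasis _)]
    intro B _
    apply residual_of_dense_open
    · exact isOpen_interior.union isClosed_closure.isOpen_compl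
    · intro x
      by_cases hx : x ∈ closure (O B)
      · exact closure_mono Set.subset_union_left hx
      · exact subset_closure (Or.inr hx)
  filter_upwards [h1] with f hf p hp
  rw [(TopologicalSpace.isBasis_countableBasis (Cn n)).mem_closure_iff]
  intro B hB hpB
  have hBo : IsOpen B := TopologicalSpace.isOpen_of_mem_countableBasis hB
  have hf' := Set.mem_iInter₂.1 hf B hB
  have hcl : f ∈ closure (O B) := by
    rw [mem_closure_iff_nhds]
    intro W hW
    obtain ⟨h, hhW, q, hq, m, hm, e1, e2⟩ := close_up f p hp B hBo hpB W hW A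
    refine ⟨h, hhW, ?_⟩
    rw [mem_interior_iff_mem_nhds]
    filter_upwards [robust_open A hA hδ h q m e1 e2 B hBo hq] with h' hh'
    obtain ⟨q', hq', e3, e4⟩ := hh'
    exact ⟨q', hq', hS h' q' m hm e3 e4⟩
  rcases hf' with hf' | hf'
  · have h6 : f ∈ {f | (B ∩ S f).Nonempty} := interior_subset hf'
    exact h6
  · exact absurd hcl hf'

lemma rne_open (f : Endo n) : IsOpen (rne f) := by
  rw [isOpen_iff_forall_mem_open]
  rintro p ⟨U, hU, hpU, V, hV, K, hK, h⟩
  exact ⟨U, fun x hx => ⟨U, hU, hx, V, hV, K, hK, h⟩, hU, hpU⟩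

lemma minPer_pos {f : Endo n} {p : Cn n} (h : IsPer f p) : 0 < minPer f p := by
  obtain ⟨m, hm, e⟩ := h
  exact Function.IsPeriodicPt.minimalPeriod_pos (n := m) hm e

lemma minPer_fix (f : Endo n) (p : Cn n) : (eapp f)^[minPer f p] p = p :=
  Function.iterate_minimalPeriod

lemma not_rne [Nontrivial (Cn n)] (f : Endo n) (p : Cn n) (z : ℂ) (hz : z ∈ eigs f p)
    (h1 : 1 < ‖z‖) : p ∉ rne f := by
  rintro ⟨U, hU, hpU, V, hV, K, hK, h⟩
  have hf := h f (mem_of_mem_nhds hV)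
  obtain ⟨M, hM, hKM⟩ := hK.isBounded.exists_pos_norm_le
  obtain ⟨r, hr, hrU⟩ := Metric.isOpen_iff.1 hU p hpU
  set m := minPer f p with hm
  obtain ⟨k, hk⟩ := pow_unbounded_of_one_lt (2 * M / r) h1
  have hd : HasFDerivAt (((eapp f)^[m])^[k]) ((fderiv ℂ ((eapp f)^[m]) p) ^ k) p :=
    HasFDerivAt.iterate ((eapp_diff f).iterate m p).hasFDerivAt (minPer_fix f p) k
  have hb := cauchy_bd (((eapp f)^[m])^[k]) (((eapp_diff f).iterate m).iterate k) p hr (M := M)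
    (fun z hz => hKM _ (by
      rw [← Function.iterate_mul]
      exact hf (m * k) ⟨z, hrU hz, rfl⟩))
  rw [hd.fderiv] at hb
  have hs : z ^ k ∈ spectrum ℂ ((fderiv ℂ ((eapp f)^[m]) p) ^ k) := spectrum.pow_mem_pow _ k hz
  have := spectrum.norm_le_norm_of_mem hs
  rw [norm_pow] at this
  linarith

lemma eigs_pow {f : Endo n} {q : Cn n} {m : ℕ} (hm : 1 ≤ m) (hq : (eapp f)^[m] q = q) :
    ∃ k : ℕ, k ≠ 0 ∧ spectrum ℂ (fderiv ℂ ((eapp f)^[m]) q) = (fun z => z ^ k) '' eigs f q := by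
  have hdvd : minPer f q ∣ m := Function.IsPeriodicPt.minimalPeriod_dvd hq
  obtain ⟨k, hk⟩ := hdvd
  have hk0 : k ≠ 0 := by rintro rfl; omega
  refine ⟨k, hk0, ?_⟩
  have hd : HasFDerivAt (((eapp f)^[minPer f q])^[k]) ((fderiv ℂ ((eapp f)^[minPer f q]) q) ^ k) q :=
    HasFDerivAt.iterate ((eapp_diff f).iterate _ q).hasFDerivAt (minPer_fix f q) k
  rw [← Function.iterate_mul, ← hk] at hd
  rw [hd.fderiv, spectrum.map_pow_of_pos _ (Nat.pos_of_ne_zero hk0)]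
  rfl

lemma mem_att {f : Endo n} {q : Cn n} {m : ℕ} (hm : 1 ≤ m) (hq : (eapp f)^[m] q = q)
    (h : ∀ z ∈ spectrum ℂ (fderiv ℂ ((eapp f)^[m]) q), ‖z‖ < 1) : q ∈ attSet f := by
  obtain ⟨k, hk, e⟩ := eigs_pow hm hq
  refine ⟨⟨m, hm, hq⟩, fun z hz => ?_⟩
  have := h (z ^ k) (e ▸ ⟨z, hz, rfl⟩)
  rw [norm_pow] at this
  exact (pow_lt_one_iff_of_nonneg (norm_nonneg _) hk).1 this

lemma mem_rep {f : Endo n} {q : Cn n} {m : ℕ} (hm : 1 ≤ m) (hq : (eapp f)^[m] q = q)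
    (h : ∀ z ∈ spectrum ℂ (fderiv ℂ ((eapp f)^[m]) q), 1 < ‖z‖) : q ∈ repSet f := by
  obtain ⟨k, hk, e⟩ := eigs_pow hm hq
  refine ⟨⟨m, hm, hq⟩, fun z hz => ?_⟩
  have := h (z ^ k) (e ▸ ⟨z, hz, rfl⟩)
  rw [norm_pow] at this
  exact (one_lt_pow_iff_of_nonneg (norm_nonneg _) hk).1 this

lemma mem_sad {f : Endo n} {q : Cn n} {m : ℕ} (hm : 1 ≤ m) (hq : (eapp f)^[m] q = q)
    (h : ∀ z ∈ spectrum ℂ (fderiv ℂ ((eapp f)^[m]) q), ‖z‖ ≠ 1)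
    (h1 : ∃ z ∈ spectrum ℂ (fderiv ℂ ((eapp f)^[m]) q), ‖z‖ < 1)
    (h2 : ∃ z ∈ spectrum ℂ (fderiv ℂ ((eapp f)^[m]) q), 1 < ‖z‖) : q ∈ sadSet f := by
  obtain ⟨k, hk, e⟩ := eigs_pow hm hq
  rw [e] at h h1 h2
  refine ⟨⟨⟨m, hm, hq⟩, fun z hz h0 => ?_⟩, ?_, ?_⟩
  · have := h (z ^ k) ⟨z, hz, rfl⟩
    rw [norm_pow, h0] at this
    simp at this
  · obtain ⟨_, ⟨z, hz, rfl⟩, hlt⟩ := h1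
    refine ⟨z, hz, ?_⟩
    simp only [norm_pow] at hlt
    exact (pow_lt_one_iff_of_nonneg (norm_nonneg _) hk).1 hlt
  · obtain ⟨_, ⟨z, hz, rfl⟩, hlt⟩ := h2
    refine ⟨z, hz, ?_⟩
    simp only [norm_pow] at hlt
    exact (one_lt_pow_iff_of_nonneg (norm_nonneg _) hk).1 hlt

lemma multiset_bd (c : ℂ) {ε : ℝ} (s : Multiset ℂ) (h : ∀ x ∈ s, ‖x - c‖ ≤ ε) :
    ‖s.sum - s.card * c‖ ≤ s.card * ε := by
  induction s using Multiset.induction_on with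
  | empty => simp
  | cons a s ih =>
    have h1 := ih fun x hx => h x (Multiset.mem_cons_of_mem hx)
    have h2 := h a (Multiset.mem_cons_self a s)
    rw [Multiset.sum_cons, Multiset.card_cons]
    push_cast
    have e : a + s.sum - ((s.card : ℂ) + 1) * c = (a - c) + (s.sum - s.card * c) := by ring
    rw [e]
    refine (norm_add_le _ _).trans ?_
    linarith

lemma trace_bd (T : Cn n →L[ℂ] Cn n) (c : ℂ) {ε : ℝ} (h : ∀ x ∈ spectrum ℂ T, ‖x - c‖ ≤ ε) :
    ‖LinearMap.trace ℂ (Cn n) (T : Cn n →ₗ[ℂ] Cn n) - n * c‖ ≤ n * ε := by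
  set T' : Module.End ℂ (Cn n) := (T : Cn n →ₗ[ℂ] Cn n) with hT'
  have hsplit : T'.charpoly.Splits := IsAlgClosed.splits _
  have hsp : spectrum ℂ T' = spectrum ℂ T :=
    AlgEquiv.spectrum_eq (Module.End.toContinuousLinearMap (𝕜 := ℂ) (Cn n)).symm T
  have hcard : T'.charpoly.roots.card = n := by
    rw [← hsplit.natDegree_eq_card_roots, LinearMap.charpoly_natDegree]; simp
  rw [Module.End.trace_eq_sum_roots_charpoly_of_splits hsplit]
  have := multiset_bd c (ε := ε) T'.charpoly.roots (fun x hx => h x (by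
    rw [← hsp, Module.End.mem_spectrum_iff_isRoot_charpoly]
    exact Polynomial.isRoot_of_mem_roots hx))
  rwa [hcard] at this

lemma ev_quad {E : Type*} [NormedRing E] [NormedAlgebra ℂ E] (A : E) (hA : A * A = (2 : ℂ) • A)
    {η : ℝ} (hη : 0 < η) : ∀ᶠ T in 𝓝 A, ‖T * T - (2 : ℂ) • T‖ < η := by
  have : Continuous fun T : E => ‖T * T - (2 : ℂ) • T‖ := by fun_prop
  exact this.continuousAt.eventually_lt continuousAt_const (by
    rw [hA, sub_self, norm_zero]; exact hη)

lemma sad_lin (hn : 2 ≤ n) : ∃ A : Cn n →L[ℂ] Cn n, A * A = (2 : ℂ) • A ∧ ∃ δ : ℝ, 0 < δ ∧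
    ∀ T : Cn n →L[ℂ] Cn n, ‖T - A‖ ≤ δ → (∀ z ∈ spectrum ℂ T, ‖z‖ ≠ 1) ∧
      (∃ z ∈ spectrum ℂ T, ‖z‖ < 1) ∧ (∃ z ∈ spectrum ℂ T, 1 < ‖z‖) := by
  let i0 : Fin n := ⟨0, by omega⟩
  have : Nonempty (Fin n) := ⟨i0⟩
  let v : Cn n := EuclideanSpace.single i0 (2 : ℂ)
  let A : Cn n →L[ℂ] Cn n := ContinuousLinearMap.smulRight (EuclideanSpace.proj i0 : Cn n →L[ℂ] ℂ) v
  have hAapp : ∀ x, A x = x i0 • v := fun x => rfl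
  have hv : v i0 = 2 := by simp [v]
  have hA : A * A = (2 : ℂ) • A := by
    ext1 x
    simp only [mul_apply_eq_comp, _root_.smul_apply, hAapp, PiLp.smul_apply, hv]
    rw [smul_eq_mul, mul_comm, smul_smul]
  have htr : LinearMap.trace ℂ (Cn n) (A : Cn n →ₗ[ℂ] Cn n) = 2 := by
    have : (A : Cn n →ₗ[ℂ] Cn n) =
      LinearMap.smulRight ((EuclideanSpace.proj i0 : Cn n →L[ℂ] ℂ) : Cn n →ₗ[ℂ] ℂ) v := rfl
    rw [this, LinearMap.trace_smulRight]
    exact hv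
  let tr : (Cn n →L[ℂ] Cn n) →ₗ[ℂ] ℂ := (LinearMap.trace ℂ (Cn n)).comp (ContinuousLinearMap.coeLM ℂ)
  have htrc : Continuous tr := LinearMap.continuous_of_finiteDimensional tr
  have htrA : tr A = 2 := htr
  have hnR : (2 : ℝ) ≤ n := by exact_mod_cast hn
  set ε : ℝ := 1 / (4 * n) with hε
  have hεpos : 0 < ε := by positivity
  have hnε : n * ε = 1 / 4 := by rw [hε]; field_simp
  have hε8 : ε ≤ 1 / 8 := by nlinarith
  have ev1 : ∀ᶠ T in 𝓝 A, ‖tr T - 2‖ < 1 / 2 := by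
    have : Continuous fun T => ‖tr T - 2‖ := (htrc.sub continuous_const).norm
    exact this.continuousAt.eventually_lt continuousAt_const (by simp [htrA])
  have ev2 : ∀ᶠ T in 𝓝 A, ‖T * T - (2 : ℂ) • T‖ < ε * ε := ev_quad A hA (by positivity)
  obtain ⟨δ, hδ, hball⟩ := Metric.eventually_nhds_iff_ball.1 (ev1.and ev2)
  refine ⟨A, hA, δ / 2, by positivity, fun T hT => ?_⟩
  obtain ⟨h1, h2⟩ := hball T (by rw [mem_ball, dist_eq_norm]; linarith)
  have hdich : ∀ z ∈ spectrum ℂ T, ‖z - 0‖ ≤ ε ∨ ‖z - 2‖ ≤ ε := by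
    intro z hz
    have hp := spectrum.subset_polynomial_aeval T (Polynomial.X ^ 2 - Polynomial.C (2 : ℂ) * Polynomial.X) ⟨z, hz, rfl⟩
    have e : Polynomial.aeval T (Polynomial.X ^ 2 - Polynomial.C (2 : ℂ) * Polynomial.X) = T * T - (2 : ℂ) • T := by
      simp [sq]
      exact (Algebra.smul_def (2 : ℂ) T).symm
    rw [e] at hp
    have h3 := (spectrum.norm_le_norm_of_mem hp).trans_lt h2
    have e2 : Polynomial.eval z (Polynomial.X ^ 2 - Polynomial.C (2 : ℂ) * Polynomial.X) = (z - 0) * (z - 2) := by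
      simp; ring
    simp only [e2, norm_mul] at h3
    by_contra! hcon
    have := mul_lt_mul'' hcon.1 hcon.2 hεpos.le hεpos.le
    linarith
  have hsmall : ∀ z : ℂ, ‖z - 0‖ ≤ ε → ‖z‖ < 1 := fun z hz => by rw [sub_zero] at hz; linarith
  have hbig : ∀ z : ℂ, ‖z - 2‖ ≤ ε → 1 < ‖z‖ := fun z hz => by
    have := norm_sub_norm_le (2 : ℂ) z
    rw [norm_sub_rev] at this
    have h2 : ‖(2 : ℂ)‖ = 2 := by simp
    linarith
  refine ⟨fun z hz => ?_, ?_, ?_⟩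
  · rcases hdich z hz with h | h
    · exact (hsmall z h).ne
    · exact (hbig z h).ne'
  · by_contra! hcon
    have h3 := trace_bd T 2 (ε := ε) (fun z hz => (hdich z hz).resolve_left fun h => by
      linarith [hsmall z h, hcon z hz])
    change ‖tr T - n * 2‖ ≤ n * ε at h3
    rw [hnε] at h3
    have h4 : ‖((n : ℂ) * 2 - 2)‖ ≤ 1 / 2 + 1 / 4 := by
      have e : ((n : ℂ) * 2 - 2) = (tr T - 2) - (tr T - n * 2) := by ring
      rw [e]
      exact (norm_sub_le _ _).trans (by linarith)
    have h5 : ((n : ℂ) * 2 - 2) = (((n : ℝ) * 2 - 2 : ℝ) : ℂ) := by push_cast; ring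
    rw [h5, Complex.norm_real, Real.norm_eq_abs] at h4
    linarith [le_abs_self ((n : ℝ) * 2 - 2)]
  · by_contra! hcon
    have h3 := trace_bd T 0 (ε := ε) (fun z hz => (hdich z hz).resolve_right fun h => by
      linarith [hbig z h, hcon z hz])
    change ‖tr T - n * 0‖ ≤ n * ε at h3
    rw [hnε, mul_zero, sub_zero] at h3
    have h4 : ‖(2 : ℂ)‖ ≤ 1 / 2 + 1 / 4 := by
      have e : (2 : ℂ) = tr T - (tr T - 2) := by ring
      rw [e]
      exact (norm_sub_le _ _).trans (by linarith)
    have h5 : ‖(2 : ℂ)‖ = 2 := by simp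
    linarith

/-- For a generic endomorphism `f` of `ℂⁿ`: `ℂⁿ \\ rne(f)` lies in the closure of `att(f)`,
equals the closure of `rep(f)`, and, if `n ≥ 2`, equals the closure of `sad(f)`. -/
theorem stmt_4 (n : ℕ) (hn : 1 ≤ n) :
    {f : Endo n | (rne f)ᶜ ⊆ closure (attSet f) ∧ (rne f)ᶜ = closure (repSet f) ∧
      (2 ≤ n → (rne f)ᶜ = closure (sadSet f))} ∈ residual (Endo n) := by
  have : Nonempty (Fin n) := ⟨⟨0, by omega⟩⟩
  have hatt : {f : Endo n | (rne f)ᶜ ⊆ closure (attSet f)} ∈ residual (Endo n) := by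
    refine generic_subset attSet 0 (by ext1 x; simp) (δ := 1 / 2) (by norm_num) ?_
    intro f q m hm hq hd
    refine mem_att hm hq fun z hz => ?_
    rw [sub_zero] at hd
    linarith [spectrum.norm_le_norm_of_mem hz]
  have hrep : {f : Endo n | (rne f)ᶜ ⊆ closure (repSet f)} ∈ residual (Endo n) := by
    refine generic_subset repSet ((2 : ℂ) • 1) (by ext1 x; simp) (δ := 1 / 2) (by norm_num) ?_
    intro f q m hm hq hd
    refine mem_rep hm hq fun z hz => ?_
    have h1 : z - 2 ∈ spectrum ℂ (fderiv ℂ ((eapp f)^[m]) q - (2 : ℂ) • 1) := by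
      rw [← Algebra.algebraMap_eq_smul_one, ← spectrum.sub_singleton_eq]
      exact Set.sub_mem_sub hz rfl
    have h2 := spectrum.norm_le_norm_of_mem h1
    have h3 := norm_sub_norm_le (2 : ℂ) z
    rw [norm_sub_rev] at h3
    have h4 : ‖(2 : ℂ)‖ = 2 := by simp
    linarith
  have hsad : {f : Endo n | 2 ≤ n → (rne f)ᶜ ⊆ closure (sadSet f)} ∈ residual (Endo n) := by
    by_cases h : 2 ≤ n
    · obtain ⟨A, hA, δ, hδ, hT⟩ := sad_lin h
      filter_upwards [generic_subset sadSet A hA hδ (fun f q m hm hq hd =>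
        mem_sad hm hq (hT _ hd).1 (hT _ hd).2.1 (hT _ hd).2.2)] with f hf _
      exact hf
    · exact Filter.univ_mem' fun f h' => absurd h' h
  filter_upwards [hatt, hrep, hsad] with f h1 h2 h3
  refine ⟨h1, subset_antisymm h2 ?_, fun hn2 => subset_antisymm (h3 hn2) ?_⟩
  · refine closure_minimal ?_ (rne_open f).isClosed_compl
    intro p hp
    obtain ⟨z, hz⟩ := spectrum.nonempty_of_isAlgClosed_of_finiteDimensional ℂ
      (fderiv ℂ ((eapp f)^[minPer f p]) p)
    exact not_rne f p z hz (hp.2 z hz)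
  · refine closure_minimal ?_ (rne_open f).isClosed_compl
    intro p hp
    obtain ⟨z, hz, hz1⟩ := hp.2.2
    exact not_rne f p z hz hz1
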